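/- Let n ≥ 1, let q ≥ 2 be a natural number, and let ζ = Complex.exp(2 * π * I / q). Then no continuous selfmap f of the unit sphere of EuclideanSpace ℂ (Fin n) satisfying f(ζ • x) = ζ • f(x) for all x is nullhomotopic (homotopic to a constant map). -/

import Mathlib

namespace OrderedChain

open FreeAbelianGroup

variable {X Y : Type*}

/-- Prepend a vertex to every tuple of a chain. -/
def cons (x : X) : FreeAbelianGroup (List X) →+ FreeAbelianGroup (List X) :=
  FreeAbelianGroup.map (List.cons x)

@[simp]
lemma cons_of (x : X) (l : List X) : cons x (of l) = of (x :: l) :=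
  FreeAbelianGroup.map_of_apply l

/-- The boundary of an ordered tuple in the augmented complex of ordered tuples. -/
def boundaryList : List X → FreeAbelianGroup (List X)
  | [] => 0
  | x :: l => of l - cons x (boundaryList l)

/-- The boundary operator of the augmented complex of ordered tuples. -/
def boundary : FreeAbelianGroup (List X) →+ FreeAbelianGroup (List X) :=
  FreeAbelianGroup.lift boundaryList

@[simp]
lemma boundary_of_nil : boundary (of ([] : List X)) = 0 := by
  simp [boundary, boundaryList]

@[simp]
lemma boundary_of_cons (x : X) (l : List X) :
    boundary (of (x :: l)) = of l - cons x (boundary (of l)) := by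
  simp [boundary, boundaryList]

@[simp]
lemma boundary_cons (x : X) (z : FreeAbelianGroup (List X)) :
    boundary (cons x z) = z - cons x (boundary z) := by
  have : boundary.comp (cons x) = AddMonoidHom.id _ - (cons x).comp boundary := by
    ext l
    simp
  exact DFunLike.congr_fun this z

/-- The chain map induced by a map of vertices. -/
def push (h : X → Y) : FreeAbelianGroup (List X) →+ FreeAbelianGroup (List Y) :=
  FreeAbelianGroup.map (List.map h)

@[simp]
lemma push_of (h : X → Y) (l : List X) : push h (of l) = of (l.map h) :=
  FreeAbelianGroup.map_of_apply l

@[simp]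
lemma push_cons (h : X → Y) (x : X) (z : FreeAbelianGroup (List X)) :
    push h (cons x z) = cons (h x) (push h z) := by
  have : (push h).comp (cons x) = (cons (h x)).comp (push h) := by
    ext l
    simp
  exact DFunLike.congr_fun this z

@[simp]
lemma push_id (z : FreeAbelianGroup (List X)) : push id z = z := by
  have : push id = AddMonoidHom.id (FreeAbelianGroup (List X)) := by
    ext l
    simp
  exact DFunLike.congr_fun this z

lemma push_push {W : Type*} (h : X → Y) (h' : Y → W) (z : FreeAbelianGroup (List X)) :
    push h' (push h z) = push (h' ∘ h) z := by
  have : (push h').comp (push h) = push (h' ∘ h) := by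
    ext l
    simp
  exact DFunLike.congr_fun this z

lemma boundary_push (h : X → Y) (z : FreeAbelianGroup (List X)) :
    boundary (push h z) = push h (boundary z) := by
  have : boundary.comp (push h) = (push h).comp boundary := by
    ext l
    induction l with
    | nil => simp
    | cons x l ih => simpa using congrArg (cons (h x)) ih
  exact DFunLike.congr_fun this z

/-- The prism over an ordered tuple. -/
def prismList (h h' : X → Y) : List X → FreeAbelianGroup (List Y)
  | [] => 0
  | x :: l => of (h x :: h' x :: l.map h') - cons (h x) (prismList h h' l)

/-- The prism operator, a chain homotopy between two maps of vertices. -/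
def prism (h h' : X → Y) : FreeAbelianGroup (List X) →+ FreeAbelianGroup (List Y) :=
  FreeAbelianGroup.lift (prismList h h')

@[simp]
lemma prism_of_nil (h h' : X → Y) : prism h h' (of []) = 0 := by
  simp [prism, prismList]

@[simp]
lemma prism_of_cons (h h' : X → Y) (x : X) (l : List X) :
    prism h h' (of (x :: l)) =
      of (h x :: h' x :: l.map h') - cons (h x) (prism h h' (of l)) := by
  simp [prism, prismList]

@[simp]
lemma prism_cons (h h' : X → Y) (x : X) (z : FreeAbelianGroup (List X)) :
    prism h h' (cons x z) =
      cons (h x) (cons (h' x) (push h' z)) - cons (h x) (prism h h' z) := by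
  have : (prism h h').comp (cons x) =
      (cons (h x)).comp ((cons (h' x)).comp (push h')) - (cons (h x)).comp (prism h h') := by
    ext l
    simp
  exact DFunLike.congr_fun this z

lemma boundary_prism (h h' : X → Y) (z : FreeAbelianGroup (List X)) :
    boundary (prism h h' z) = push h' z - push h z - prism h h' (boundary z) := by
  have : boundary.comp (prism h h') = push h' - push h - (prism h h').comp boundary := by
    ext l
    induction l with
    | nil => simp
    | cons x l ih =>
      have ih' : boundary (prism h h' (of l)) =
          of (l.map h') - of (l.map h) - prism h h' (boundary (of l)) := by simpa using ih
      have hb : boundary (of (l.map h')) = push h' (boundary (of l)) := by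
        rw [← boundary_push, push_of]
      simp [ih', hb]
      abel
  exact DFunLike.congr_fun this z

/-- The group of chains generated by the tuples satisfying a predicate. -/
def span (P : List X → Prop) : AddSubgroup (FreeAbelianGroup (List X)) :=
  AddSubgroup.closure (of '' {l | P l})

lemma of_mem_span {P : List X → Prop} {l : List X} (hl : P l) : of l ∈ span P :=
  AddSubgroup.subset_closure ⟨l, hl, rfl⟩

lemma map_mem_of_span {G : Type*} [AddCommGroup G] {P : List X → Prop} {H : AddSubgroup G}
    (f : FreeAbelianGroup (List X) →+ G) (hf : ∀ l, P l → f (of l) ∈ H)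
    {z : FreeAbelianGroup (List X)} (hz : z ∈ span P) : f z ∈ H := by
  have : span P ≤ H.comap f := by
    rw [span, AddSubgroup.closure_le]
    rintro _ ⟨l, hl, rfl⟩
    exact hf l hl
  exact this hz

lemma hom_eq_of_span {G : Type*} [AddCommGroup G] {P : List X → Prop}
    (f g : FreeAbelianGroup (List X) →+ G) (hfg : ∀ l, P l → f (of l) = g (of l))
    {z : FreeAbelianGroup (List X)} (hz : z ∈ span P) : f z = g z := by
  have := map_mem_of_span (H := ⊥) (f - g) (fun l hl => by simp [hfg l hl]) hz
  simpa [sub_eq_zero] using this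

lemma span_mono {P Q : List X → Prop} (h : ∀ l, P l → Q l) : span P ≤ span Q :=
  AddSubgroup.closure_mono (Set.image_mono h)

lemma prism_of_mem_span (h h' : X → Y) (l : List X) :
    prism h h' (of l) ∈ span fun k : List Y =>
      k.length = l.length + 1 ∧ ∀ y ∈ k, ∃ x ∈ l, y = h x ∨ y = h' x := by
  induction l with
  | nil => simp [zero_mem]
  | cons x l ih =>
    rw [prism_of_cons]
    refine sub_mem (of_mem_span ⟨by simp, ?_⟩)
      (map_mem_of_span _ (fun k hk => ?_) ih)
    · intro y hy
      simp only [List.mem_cons, List.mem_map] at hy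
      rcases hy with rfl | rfl | ⟨a, ha, rfl⟩
      · exact ⟨x, by simp, Or.inl rfl⟩
      · exact ⟨x, by simp, Or.inr rfl⟩
      · exact ⟨a, by simp [ha], Or.inr rfl⟩
    · rw [cons_of]
      refine of_mem_span ⟨by simp [hk.1], ?_⟩
      intro y hy
      rcases List.mem_cons.1 hy with rfl | hy
      · exact ⟨x, by simp, Or.inl rfl⟩
      · obtain ⟨a, ha, h⟩ := hk.2 y hy
        exact ⟨a, by simp [ha], h⟩

/-- A tuple of `m` points of `A` which are pairwise at distance less than `ε`. -/
structure IsSmall [PseudoMetricSpace X] (m : ℕ) (A : Set X) (ε : ℝ) (l : List X) : Prop where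
  length_eq : l.length = m
  mem : ∀ x ∈ l, x ∈ A
  dist_lt : ∀ x ∈ l, ∀ y ∈ l, dist x y < ε

/-- A small cycle in a bounded set bounds a small chain in any cone over that set. -/
lemma exists_boundary_eq {E : Type*} [NormedAddCommGroup E] [NormedSpace ℝ E] {A B : Set E}
    {v : E} {m : ℕ} {ε : ℝ} (hε : 0 < ε) (hA : Bornology.IsBounded A) (hv : v ∈ B)
    (hB : ∀ x ∈ A, ∀ t ∈ Set.Icc (0 : ℝ) 1, (1 - t) • x + t • v ∈ B)
    {z : FreeAbelianGroup (List E)} (hz : z ∈ span (IsSmall m A (ε / 2)))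
    (hz0 : boundary z = 0) :
    ∃ c ∈ span (IsSmall (m + 1) B ε), boundary c = z := by
  obtain ⟨R, hR0, hR⟩ : ∃ R : ℝ, 0 < R ∧ ∀ x ∈ A, ‖x - v‖ ≤ R := by
    obtain ⟨R, hR⟩ := hA.subset_closedBall v
    refine ⟨max R 1, by positivity, fun x hx => ?_⟩
    have := hR hx
    rw [Metric.mem_closedBall, dist_eq_norm] at this
    exact this.trans (le_max_left _ _)
  obtain ⟨M, hM⟩ := exists_nat_gt (2 * R / ε)
  have hM0 : (0 : ℝ) < M := lt_of_le_of_lt (by positivity) hM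
  set h : ℕ → E → E := fun i x => (1 - (i : ℝ) / M) • x + ((i : ℝ) / M) • v with hh
  have h0 : h 0 = id := by ext x; simp [hh]
  have hMv : h M = fun _ => v := by ext x; simp [hh, hM0.ne']
  have hmem : ∀ i ≤ M, ∀ x ∈ A, h i x ∈ B := fun i hi x hx =>
    hB x hx _ ⟨by positivity, (div_le_one hM0).2 (by exact_mod_cast hi)⟩
  have hdist : ∀ i ≤ M, ∀ x y, dist (h i x) (h i y) ≤ dist x y := by
    intro i hi x y
    have h1 : (i : ℝ) / M ≤ 1 := (div_le_one hM0).2 (by exact_mod_cast hi)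
    have h2 : (0 : ℝ) ≤ (i : ℝ) / M := by positivity
    rw [hh, dist_add_right, dist_smul₀, Real.norm_of_nonneg (by linarith)]
    exact mul_le_of_le_one_left dist_nonneg (by linarith)
  have hstep : ∀ i, ∀ x ∈ A, dist (h i x) (h (i + 1) x) < ε / 2 := by
    intro i x hx
    have : h i x - h (i + 1) x = (1 / (M : ℝ)) • (x - v) := by
      simp only [hh]
      push_cast
      module
    rw [dist_eq_norm, this, norm_smul, Real.norm_of_nonneg (by positivity)]
    have h1 := hR x hx
    rw [div_lt_iff₀ hε] at hM
    rw [one_div, inv_mul_lt_iff₀ hM0]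
    linarith
  refine ⟨cons v (push (h M) z) - ∑ i ∈ Finset.range M, prism (h i) (h (i + 1)) z, ?_, ?_⟩
  · refine sub_mem ?_ (sum_mem fun i hi => ?_)
    · refine map_mem_of_span ((cons v).comp (push (h M))) (fun l hl => ?_) hz
      have hall : ∀ x ∈ v :: l.map (h M), x = v := by
        intro x hx
        simp only [hMv, List.mem_cons, List.mem_map] at hx
        aesop
      simp only [AddMonoidHom.comp_apply, push_of, cons_of]
      refine of_mem_span ⟨by simp [hl.length_eq], fun x hx => hall x hx ▸ hv,
        fun x hx y hy => ?_⟩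
      rw [hall x hx, hall y hy, dist_self]
      exact hε
    · have hi' : i + 1 ≤ M := Finset.mem_range.1 hi
      refine map_mem_of_span _ (fun l hl => span_mono ?_ (prism_of_mem_span _ _ l)) hz
      rintro k ⟨hk, hkl⟩
      refine ⟨by rw [hk, hl.length_eq], fun y hy => ?_, fun y hy y' hy' => ?_⟩
      · obtain ⟨x, hx, rfl | rfl⟩ := hkl y hy
        · exact hmem i (by omega) x (hl.mem x hx)
        · exact hmem (i + 1) hi' x (hl.mem x hx)
      · obtain ⟨x, hx, hyx⟩ := hkl y hy
        obtain ⟨x', hx', hyx'⟩ := hkl y' hy'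
        have e1 := hl.dist_lt x hx x' hx'
        have e2 := hdist i (by omega) x x'
        have e3 := hdist (i + 1) hi' x x'
        have e4 := hstep i x (hl.mem x hx)
        have e5 := hstep i x' (hl.mem x' hx')
        have e6 := dist_triangle (h i x) (h i x') (h (i + 1) x')
        have e7 := dist_triangle_left (h (i + 1) x) (h i x') (h i x)
        have e8 := dist_triangle (h (i + 1) x) (h (i + 1) x') (h i x')
        rw [dist_comm (h (i + 1) x') (h i x')] at e8
        rcases hyx with rfl | rfl <;> rcases hyx' with rfl | rfl <;> linarith
  · have hsum : boundary (∑ i ∈ Finset.range M, prism (h i) (h (i + 1)) z) =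
        push (h M) z - push (h 0) z := by
      rw [map_sum, ← Finset.sum_range_sub (fun i => push (h i) z)]
      exact Finset.sum_congr rfl fun i _ => by simp [boundary_prism, hz0]
    rw [map_sub, hsum, boundary_cons, boundary_push, hz0, h0]
    simp

/-- The additive extension of a cochain to chains. -/
def eval (φ : List X → ℝ) : FreeAbelianGroup (List X) →+ ℝ :=
  FreeAbelianGroup.lift φ

@[simp]
lemma eval_of (φ : List X → ℝ) (l : List X) : eval φ (of l) = φ l :=
  FreeAbelianGroup.lift_apply_of φ l

/-- A cochain whose coboundary vanishes on tuples of `m + 1` points. -/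
def IsCocycle (m : ℕ) (φ : List X → ℝ) : Prop :=
  ∀ l : List X, l.length = m + 1 → eval φ (boundary (of l)) = 0

/-- The cup product of a `0`-cochain with a cochain. -/
def cupZero (g : X → ℝ) (φ : List X → ℝ) : List X → ℝ
  | x :: l => g x * φ (x :: l)
  | [] => 0

/-- The cup product of a `1`-cochain with a cochain. -/
def cupOne (c : X → X → ℝ) (φ : List X → ℝ) : List X → ℝ
  | x :: y :: l => c x y * φ (y :: l)
  | _ => 0

/-- The cup product of the coboundary of the `1`-cochain `c` with a cochain. -/
def cupTwo (c : X → X → ℝ) (φ : List X → ℝ) : List X → ℝ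
  | x :: y :: z :: l => (c x y + c y z - c x z) * φ (z :: l)
  | _ => 0

lemma eval_cupZero_cons (g : X → ℝ) (φ : List X → ℝ) (x : X) (w : FreeAbelianGroup (List X)) :
    eval (cupZero g φ) (cons x w) = g x * eval φ (cons x w) := by
  have : (eval (cupZero g φ)).comp (cons x) =
      (AddMonoidHom.mulLeft (g x)).comp ((eval φ).comp (cons x)) := by
    ext l
    simp [cupZero]
  exact DFunLike.congr_fun this w

lemma eval_cupOne_cons (c : X → X → ℝ) (φ : List X → ℝ) (x y : X)
    (w : FreeAbelianGroup (List X)) :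
    eval (cupOne c φ) (cons x (cons y w)) = c x y * eval φ (cons y w) := by
  have : (eval (cupOne c φ)).comp ((cons x).comp (cons y)) =
      (AddMonoidHom.mulLeft (c x y)).comp ((eval φ).comp (cons y)) := by
    ext l
    simp [cupOne]
  exact DFunLike.congr_fun this w

lemma eval_cupTwo_cons (c : X → X → ℝ) (φ : List X → ℝ) (x y z : X)
    (w : FreeAbelianGroup (List X)) :
    eval (cupTwo c φ) (cons x (cons y (cons z w))) =
      (c x y + c y z - c x z) * eval φ (cons z w) := by
  have : (eval (cupTwo c φ)).comp ((cons x).comp ((cons y).comp (cons z))) =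
      (AddMonoidHom.mulLeft (c x y + c y z - c x z)).comp ((eval φ).comp (cons z)) := by
    ext l
    simp [cupTwo]
  exact DFunLike.congr_fun this w

lemma eval_cupZero_boundary {m : ℕ} {φ : List X → ℝ} (hφ : IsCocycle (m + 1) φ) (g : X → ℝ)
    (l : List X) (hl : l.length = m + 2) :
    eval (cupZero g φ) (boundary (of l)) = cupOne (fun x y => g y - g x) φ l := by
  match l, hl with
  | x :: y :: l, hl =>
    have h := hφ (x :: y :: l) hl
    simp only [boundary_of_cons, map_sub, cons_of, eval_of, eval_cupZero_cons] at h ⊢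
    simp only [cupZero, cupOne]
    linear_combination g x * h

lemma eval_cupOne_boundary {m : ℕ} {φ : List X → ℝ} (hφ : IsCocycle (m + 1) φ)
    (c : X → X → ℝ) (l : List X) (hl : l.length = m + 3) :
    eval (cupOne c φ) (boundary (of l)) = cupTwo c φ l := by
  match l, hl with
  | x :: y :: z :: l, hl =>
    have h := hφ (y :: z :: l) (by simpa using hl)
    simp only [boundary_of_cons, map_sub, cons_of, eval_of, eval_cupOne_cons] at h ⊢
    simp only [cupOne, cupTwo]
    linear_combination (-c x y) * h

lemma IsCocycle.cupTwo {m : ℕ} {φ : List X → ℝ} (hφ : IsCocycle (m + 1) φ) (c : X → X → ℝ) :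
    IsCocycle (m + 3) (cupTwo c φ) := by
  intro l hl
  match l, hl with
  | x :: y :: z :: u :: l, hl =>
    have h := hφ (z :: u :: l) (by simpa using hl)
    simp only [boundary_of_cons, map_sub, cons_of, eval_of, eval_cupTwo_cons] at h ⊢
    simp only [OrderedChain.cupTwo]
    linear_combination (c x y + c y z - c x z) * h

/-- The subgroup of integers inside the reals. -/
abbrev integers : AddSubgroup ℝ := (Int.castAddHom ℝ).range

lemma mul_mem_integers {a b : ℝ} (ha : a ∈ integers) (hb : b ∈ integers) : a * b ∈ integers := by
  obtain ⟨m, rfl⟩ := ha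
  obtain ⟨n, rfl⟩ := hb
  exact ⟨m * n, by simp⟩

lemma cupTwo_mem_integers {c : X → X → ℝ} {φ : List X → ℝ}
    (hc : ∀ x y z, c x y + c y z - c x z ∈ integers) (hφ : ∀ l, φ l ∈ integers) (l : List X) :
    cupTwo c φ l ∈ integers := by
  match l with
  | [] | [_] | [_, _] => exact zero_mem _
  | x :: y :: z :: l => exact mul_mem_integers (hc x y z) (hφ _)

lemma eval_push_of_invariant {P : List X → Prop} {φ : List X → ℝ} {T : X → X}
    (h : ∀ l, P l → φ (l.map T) = φ l) {z : FreeAbelianGroup (List X)} (hz : z ∈ span P) :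
    eval φ (push T z) = eval φ z :=
  hom_eq_of_span ((eval φ).comp (push T)) (eval φ) (fun l hl => by simp [h l hl]) hz

/-- Invariance of a cochain under a self-map, on tuples of points of `Z`. -/
def IsInvariant (T : X → X) (Z : Set X) (φ : List X → ℝ) : Prop :=
  ∀ l : List X, (∀ x ∈ l, x ∈ Z) → φ (l.map T) = φ l

lemma IsInvariant.cupOne {T : X → X} {Z : Set X} {φ : List X → ℝ} (hφ : IsInvariant T Z φ)
    {c : X → X → ℝ} (hc : ∀ x ∈ Z, ∀ y ∈ Z, c (T x) (T y) = c x y) :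
    IsInvariant T Z (cupOne c φ) := by
  intro l hl
  match l, hl with
  | [], _ | [_], _ => rfl
  | x :: y :: l, hl =>
    have h := hφ (y :: l) fun a ha => hl a (List.mem_cons_of_mem _ ha)
    simp only [List.map_cons] at h ⊢
    simp only [OrderedChain.cupOne]
    rw [h, hc x (hl x (by simp)) y (hl y (by simp))]

lemma IsInvariant.cupTwo {T : X → X} {Z : Set X} {φ : List X → ℝ} (hφ : IsInvariant T Z φ)
    {c : X → X → ℝ} (hc : ∀ x ∈ Z, ∀ y ∈ Z, c (T x) (T y) = c x y) :
    IsInvariant T Z (cupTwo c φ) := by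
  intro l hl
  match l, hl with
  | [], _ | [_], _ | [_, _], _ => rfl
  | x :: y :: z :: l, hl =>
    have h := hφ (z :: l) fun a ha =>
      hl a (List.mem_cons_of_mem _ (List.mem_cons_of_mem _ ha))
    have hx := hl x (by simp)
    have hy := hl y (by simp)
    have hz := hl z (by simp)
    simp only [List.map_cons] at h ⊢
    simp only [OrderedChain.cupTwo]
    rw [h, hc x hx y hy, hc y hy z hz, hc x hx z hz]

lemma IsInvariant.iterate {T : X → X} {Z : Set X} {φ : List X → ℝ} (hφ : IsInvariant T Z φ)
    (hT : Set.MapsTo T Z Z) (j : ℕ) : IsInvariant T^[j] Z φ := by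
  induction j with
  | zero => intro l _; simp
  | succ j ih =>
    intro l hl
    rw [Function.iterate_succ', ← List.map_map, hφ, ih l hl]
    intro x hx
    obtain ⟨a, ha, rfl⟩ := List.mem_map.1 hx
    exact hT.iterate j (hl a ha)

/-- The value of a cocycle on `α` agrees modulo `q` with the value on `γ` of its cup product
with the coboundary of `c`, when `c` lifts the differences of a function `g` modulo `1` that
increases by `1 / q` along the generator `T` of the action. -/
theorem eval_cupTwo_congr {T : X → X} {Z : Set X} (hT : Set.MapsTo T Z Z) {q m : ℕ}
    (hq : q ≠ 0) {φ : List X → ℝ} (hφ : IsCocycle (m + 1) φ) (hφZ : ∀ l, φ l ∈ integers)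
    (hφT : IsInvariant T Z φ) {c : X → X → ℝ} {g : X → ℝ}
    (hcT : ∀ x ∈ Z, ∀ y ∈ Z, c (T x) (T y) = c x y)
    (hcg : ∀ x y, c x y - (g y - g x) ∈ integers)
    (hg : ∀ x ∈ Z, g (T x) - g x - 1 / q ∈ integers)
    {α β γ : FreeAbelianGroup (List X)}
    (hα : α ∈ span fun l => l.length = m + 1 ∧ ∀ x ∈ l, x ∈ Z)
    (hβ : β ∈ span fun l => l.length = m + 2 ∧ ∀ x ∈ l, x ∈ Z)
    (hγ : γ ∈ span fun l => l.length = m + 3)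
    (hβα : boundary β = push T α - α)
    (hγβ : boundary γ = ∑ j ∈ Finset.range q, push T^[j] β) :
    ∃ k : ℤ, eval (cupTwo c φ) γ = eval φ α + q * k := by
  have h1 : eval (cupTwo c φ) γ = q * eval (cupOne c φ) β := by
    have e : eval (cupOne c φ) (boundary γ) = eval (cupTwo c φ) γ :=
      hom_eq_of_span ((eval (cupOne c φ)).comp boundary) _
        (fun l hl => by simpa using eval_cupOne_boundary hφ c l hl) hγ
    rw [← e, hγβ, map_sum, Finset.sum_congr rfl fun j _ =>
      eval_push_of_invariant (fun l hl => (hφT.cupOne hcT).iterate hT j l hl.2) hβ]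
    simp
  have h2 : eval (cupOne c φ) β - eval (cupOne (fun x y => g y - g x) φ) β ∈ integers := by
    refine map_mem_of_span (eval (cupOne c φ) - eval (cupOne (fun x y => g y - g x) φ))
      (fun l _ => ?_) hβ
    match l with
    | [] | [_] => simp [cupOne]
    | x :: y :: l =>
      have := mul_mem_integers (hcg x y) (hφZ (y :: l))
      simpa only [AddMonoidHom.sub_apply, eval_of, cupOne, ← sub_mul] using this
  have h3 : eval (cupOne (fun x y => g y - g x) φ) β =
      eval (cupZero g φ) (push T α) - eval (cupZero g φ) α := by
    rw [← map_sub, ← hβα]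
    exact (hom_eq_of_span ((eval (cupZero g φ)).comp boundary) _
      (fun l hl => by simpa using eval_cupZero_boundary hφ g l hl.1) hβ).symm
  have h4 : eval (cupZero g φ) (push T α) - eval (cupZero g φ) α - 1 / q * eval φ α ∈
      integers := by
    refine map_mem_of_span ((eval (cupZero g φ)).comp (push T) - eval (cupZero g φ) -
      (AddMonoidHom.mulLeft (1 / q : ℝ)).comp (eval φ)) (fun l hl => ?_) hα
    match l, hl with
    | x :: l, hl =>
      have h := mul_mem_integers (hg x (hl.2 x (by simp))) (hφZ (x :: l))
      have h' := hφT (x :: l) hl.2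
      simp only [AddMonoidHom.sub_apply, AddMonoidHom.comp_apply, push_of, eval_of,
        AddMonoidHom.coe_mulLeft]
      simp only [List.map_cons] at h' ⊢
      simp only [cupZero, h']
      convert h using 1
      ring
  obtain ⟨k, hk⟩ := add_mem h2 h4
  refine ⟨k, ?_⟩
  have hq' : (q : ℝ) ≠ 0 := by exact_mod_cast hq
  rw [h1]
  simp only [Int.coe_castAddHom] at hk
  rw [h3] at hk
  field_simp at hk
  linarith

/-- The iterated cup product of the coboundaries of the `1`-cochains `c i`. -/
def cupPower (c : ℕ → X → X → ℝ) : ℕ → List X → ℝ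
  | 0 => fun _ => 1
  | k + 1 => cupTwo (c k) (cupPower c k)

lemma isCocycle_cupPower (c : ℕ → X → X → ℝ) (k : ℕ) :
    IsCocycle (2 * k + 1) (cupPower c k) := by
  induction k with
  | zero =>
    intro l hl
    match l, hl with
    | [x, y], _ => simp [cupPower]
  | succ k ih => exact ih.cupTwo (c k)

lemma cupPower_mem_integers {c : ℕ → X → X → ℝ}
    (hc : ∀ i x y z, c i x y + c i y z - c i x z ∈ integers) (k : ℕ) (l : List X) :
    cupPower c k l ∈ integers := by
  induction k generalizing l with
  | zero => exact ⟨1, by simp [cupPower]⟩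
  | succ k ih => exact cupTwo_mem_integers (hc k) ih l

lemma isInvariant_cupPower {T : X → X} {Z : Set X} {c : ℕ → X → X → ℝ}
    (hc : ∀ i, ∀ x ∈ Z, ∀ y ∈ Z, c i (T x) (T y) = c i x y) (k : ℕ) :
    IsInvariant T Z (cupPower c k) := by
  induction k with
  | zero => intro l _; rfl
  | succ k ih => exact ih.cupTwo (hc k)

/-- An iterated cup product vanishes on a tuple on which one of the factors vanishes. -/
lemma cupPower_eq_zero {c : ℕ → X → X → ℝ} {k i : ℕ} (hi : i < k) (l : List X)
    (hc : ∀ x ∈ l, ∀ y ∈ l, ∀ z ∈ l, c i x y + c i y z - c i x z = 0) :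
    cupPower c k l = 0 := by
  induction k generalizing l with
  | zero => omega
  | succ k ih =>
    match l with
    | [] | [_] | [_, _] => rfl
    | x :: y :: z :: l =>
      simp only [cupPower, cupTwo]
      rcases Nat.lt_succ_iff_lt_or_eq.1 hi with h | rfl
      · rw [ih h (z :: l), mul_zero]
        intro a ha b hb d hd
        exact hc a (by simp_all) b (by simp_all) d (by simp_all)
      · rw [hc x (by simp) y (by simp) z (by simp), zero_mul]

lemma push_mem_span_isSmall [PseudoMetricSpace X] {T : X → X} (hT : Isometry T) {m : ℕ}
    {A B : Set X} (hAB : ∀ x ∈ A, T x ∈ B) {ε : ℝ} {z : FreeAbelianGroup (List X)}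
    (hz : z ∈ span (IsSmall m A ε)) : push T z ∈ span (IsSmall m B ε) := by
  refine map_mem_of_span _ (fun l hl => ?_) hz
  rw [push_of]
  refine of_mem_span ⟨by simp [hl.length_eq], fun x hx => ?_, fun x hx y hy => ?_⟩
  · obtain ⟨a, ha, rfl⟩ := List.mem_map.1 hx
    exact hAB a (hl.mem a ha)
  · obtain ⟨a, ha, rfl⟩ := List.mem_map.1 hx
    obtain ⟨b, hb, rfl⟩ := List.mem_map.1 hy
    rw [hT.dist_eq]
    exact hl.dist_lt a ha b hb

lemma IsSmall.mono [PseudoMetricSpace X] {m : ℕ} {A B : Set X} (hAB : A ⊆ B) {ε : ℝ}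
    {l : List X} (hl : IsSmall m A ε l) : IsSmall m B ε l :=
  ⟨hl.length_eq, fun x hx => hAB (hl.mem x hx), hl.dist_lt⟩

/-- Arbitrarily fine chains in an iterated join of orbits, on which the iterated cup product
takes values congruent to `1` modulo `q`. -/
theorem exists_small_chain {E : Type*} [NormedAddCommGroup E] [NormedSpace ℝ E]
    {T : E → E} (hT : Isometry T) {q n : ℕ} (hq : q ≠ 0) (hTq : T^[q] = id)
    {Z : Set E} (hTZ : Set.MapsTo T Z Z) {A B : ℕ → Set E} {v w : ℕ → E}
    (hA : ∀ k, Bornology.IsBounded (A k)) (hB : ∀ k, Bornology.IsBounded (B k))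
    (hv : ∀ k, v k ∈ A k) (hw : ∀ k, w k ∈ B k)
    (hAB : ∀ k, ∀ x ∈ A k, ∀ t ∈ Set.Icc (0 : ℝ) 1,
      (1 - t) • x + t • w k ∈ B k ∧ (1 - t) • T x + t • w k ∈ B k)
    (hBA : ∀ k, ∀ x ∈ B k, ∀ j < q, ∀ t ∈ Set.Icc (0 : ℝ) 1,
      (1 - t) • T^[j] x + t • v (k + 1) ∈ A (k + 1))
    (hBZ : ∀ k < n, B k ⊆ Z)
    {c : ℕ → E → E → ℝ} {g : ℕ → E → ℝ}
    (hc : ∀ i x y z, c i x y + c i y z - c i x z ∈ integers)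
    (hcT : ∀ i, ∀ x ∈ Z, ∀ y ∈ Z, c i (T x) (T y) = c i x y)
    (hcg : ∀ i x y, c i x y - (g i y - g i x) ∈ integers)
    (hg : ∀ i, ∀ x ∈ Z, g i (T x) - g i x - 1 / q ∈ integers)
    {ε : ℝ} (hε : 0 < ε) :
    ∃ α ∈ span (IsSmall (2 * n + 1) (A n) ε), ∃ k : ℤ,
      eval (cupPower c n) α = 1 + q * k := by
  suffices H : ∀ k ≤ n, ∀ ε > (0 : ℝ), ∃ α ∈ span (IsSmall (2 * k + 1) (A k) ε),
      boundary (push T α) = boundary α ∧ ∃ a : ℤ, eval (cupPower c k) α = 1 + q * a by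
    obtain ⟨α, hα, -, h⟩ := H n le_rfl ε hε
    exact ⟨α, hα, h⟩
  intro k
  induction k with
  | zero =>
    intro _ ε hε
    refine ⟨of [v 0], of_mem_span ⟨rfl, ?_, ?_⟩, by simp, 0, by simp [cupPower]⟩
    · simpa using hv 0
    · simpa using hε
  | succ k ih =>
    intro hk ε hε
    obtain ⟨α, hα, hαT, a, ha⟩ := ih (by omega) (ε / 2 / 2) (by positivity)
    have hAB' : A k ⊆ B k := fun x hx => by
      simpa using (hAB k x hx 0 (by simp)).1
    obtain ⟨β, hβ, hβα⟩ := exists_boundary_eq (A := A k ∪ T '' A k) (B := B k) (v := w k)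
      (z := push T α - α) (m := 2 * k + 1) (ε := ε / 2) (by positivity)
      ((hA k).union (hT.lipschitz.isBounded_image (hA k)))
      (hw k)
      (by
        rintro _ (hx | ⟨x, hx, rfl⟩) t ht
        · exact (hAB k _ hx t ht).1
        · exact (hAB k x hx t ht).2)
      (sub_mem (push_mem_span_isSmall hT (fun x hx => Or.inr ⟨x, hx, rfl⟩) hα)
        (span_mono (fun l hl => hl.mono Set.subset_union_left) hα))
      (by rw [map_sub, hαT, sub_self])
    have hTsum : push T (∑ j ∈ Finset.range q, push T^[j] β) =
        ∑ j ∈ Finset.range q, push T^[j] β := by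
      have h := Finset.sum_range_sub (fun j => push T^[j] β) q
      rw [hTq, Function.iterate_zero, sub_self, Finset.sum_sub_distrib, sub_eq_zero] at h
      rw [map_sum]
      refine (Finset.sum_congr rfl fun j _ => ?_).trans h
      rw [push_push, Function.iterate_succ']
    have hTj : ∀ j, Isometry T^[j] := fun j => by
      induction j with
      | zero => exact isometry_id
      | succ j ihj => rw [Function.iterate_succ']; exact hT.comp ihj
    obtain ⟨γ, hγ, hγβ⟩ := exists_boundary_eq (A := ⋃ j ∈ Finset.range q, T^[j] '' B k)
      (B := A (k + 1)) (v := v (k + 1)) (z := ∑ j ∈ Finset.range q, push T^[j] β)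
      (m := 2 * k + 2) hε
      ((Bornology.isBounded_biUnion_finset _).2 fun j _ =>
        (hTj j).lipschitz.isBounded_image (hB k))
      (hv (k + 1))
      (by
        intro y hy t ht
        simp only [Set.mem_iUnion, Finset.mem_range] at hy
        obtain ⟨j, hj, x, hx, rfl⟩ := hy
        exact hBA k x hx j hj t ht)
      (sum_mem fun j hj => push_mem_span_isSmall (hTj j)
        (fun x hx => by exact Set.mem_iUnion₂.2 ⟨j, hj, x, hx, rfl⟩) hβ)
      (by
        have h := congrArg boundary hTsum
        simp only [map_sum, boundary_push, hβα] at h ⊢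
        have h' := Finset.sum_range_sub (fun j => push T^[j] α) q
        rw [hTq, Function.iterate_zero, sub_self] at h'
        rw [← h']
        refine Finset.sum_congr rfl fun j _ => ?_
        rw [map_sub, push_push, Function.iterate_succ])
    obtain ⟨b, hb⟩ := eval_cupTwo_congr hTZ hq (isCocycle_cupPower c k)
      (cupPower_mem_integers hc k) (isInvariant_cupPower hcT k) (hcT k) (hcg k) (hg k)
      (span_mono (Q := fun l => l.length = 2 * k + 1 ∧ ∀ x ∈ l, x ∈ Z)
        (fun l hl => ⟨hl.length_eq, fun x hx => hBZ k hk (hAB' (hl.mem x hx))⟩) hα)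
      (span_mono (Q := fun l => l.length = 2 * k + 2 ∧ ∀ x ∈ l, x ∈ Z)
        (fun l hl => ⟨hl.length_eq, fun x hx => hBZ k hk (hl.mem x hx)⟩) hβ)
      (span_mono (Q := fun l => l.length = 2 * k + 3) (fun l hl => hl.length_eq) hγ) hβα hγβ
    refine ⟨γ, hγ, ?_, a + b, ?_⟩
    · rw [boundary_push, hγβ, hTsum]
    · rw [cupPower, hb, ha]
      push_cast
      ring

end OrderedChain

namespace JoinFiltration

variable {n : ℕ}

/-- The cone over `A` with apex `v`. -/
def coneOver {E : Type*} [AddCommGroup E] [Module ℝ E] (v : E) (A : Set E) : Set E :=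
  (fun p : ℝ × E => (1 - p.1) • p.2 + p.1 • v) '' (Set.Icc 0 1 ×ˢ A)

lemma isCompact_coneOver {E : Type*} [NormedAddCommGroup E] [NormedSpace ℝ E] {v : E} {A : Set E}
    (hA : IsCompact A) : IsCompact (coneOver v A) :=
  (isCompact_Icc.prod hA).image (by fun_prop)

/-- The `k`-th standard basis vector of `ℂ^n`, which is `0` when `n ≤ k`. -/
noncomputable def basisVector (n k : ℕ) : EuclideanSpace ℂ (Fin n) :=
  WithLp.toLp 2 fun i => if (i : ℕ) = k then 1 else 0

/-- The even stages of the filtration of the iterated join of `q`-gons in `ℂ^n` are given by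
coning off the orbit of an odd stage, and the odd stages by coning off two translates of an
even stage; `ω` is a square root of the generator of the action. -/
noncomputable def evenStage (n q : ℕ) (ω : ℂ) : ℕ → Set (EuclideanSpace ℂ (Fin n))
  | 0 => {basisVector n 0}
  | k + 1 => coneOver (basisVector n (k + 1)) (⋃ j ∈ Finset.range q,
      (fun x => (ω ^ 2) • x)^[j] '' coneOver (ω • basisVector n k)
        (evenStage n q ω k ∪ (fun x => (ω ^ 2) • x) '' evenStage n q ω k))

/-- The odd stages of the filtration of the iterated join of `q`-gons in `ℂ^n`. -/
noncomputable def oddStage (n q : ℕ) (ω : ℂ) (k : ℕ) : Set (EuclideanSpace ℂ (Fin n)) :=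
  coneOver (ω • basisVector n k)
    (evenStage n q ω k ∪ (fun x => (ω ^ 2) • x) '' evenStage n q ω k)

lemma isCompact_oddStage_of_isCompact_evenStage {q : ℕ} {ω : ℂ} {k : ℕ}
    (h : IsCompact (evenStage n q ω k)) : IsCompact (oddStage n q ω k) :=
  isCompact_coneOver (h.union (h.image (by fun_prop)))

lemma isCompact_evenStage (q : ℕ) (ω : ℂ) (k : ℕ) : IsCompact (evenStage n q ω k) := by
  induction k with
  | zero => exact isCompact_singleton
  | succ k ih =>
    refine isCompact_coneOver (Finset.isCompact_biUnion _ fun j _ => ?_)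
    exact (isCompact_oddStage_of_isCompact_evenStage ih).image
      ((by fun_prop : Continuous fun x : EuclideanSpace ℂ (Fin n) => (ω ^ 2) • x).iterate j)

lemma isCompact_oddStage (q : ℕ) (ω : ℂ) (k : ℕ) : IsCompact (oddStage n q ω k) :=
  isCompact_oddStage_of_isCompact_evenStage (isCompact_evenStage q ω k)

lemma mem_oddStage {q : ℕ} {ω : ℂ} {k : ℕ} {x : EuclideanSpace ℂ (Fin n)}
    (hx : x ∈ evenStage n q ω k) {t : ℝ} (ht : t ∈ Set.Icc (0 : ℝ) 1) :
    (1 - t) • x + t • (ω • basisVector n k) ∈ oddStage n q ω k ∧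
      (1 - t) • ((ω ^ 2) • x) + t • (ω • basisVector n k) ∈ oddStage n q ω k :=
  ⟨⟨(t, x), ⟨ht, Or.inl hx⟩, rfl⟩, ⟨(t, (ω ^ 2) • x), ⟨ht, Or.inr ⟨x, hx, rfl⟩⟩, rfl⟩⟩

lemma mem_evenStage_succ {q : ℕ} {ω : ℂ} {k j : ℕ} (hj : j < q)
    {x : EuclideanSpace ℂ (Fin n)} (hx : x ∈ oddStage n q ω k) {t : ℝ}
    (ht : t ∈ Set.Icc (0 : ℝ) 1) :
    (1 - t) • (fun x => (ω ^ 2) • x)^[j] x + t • basisVector n (k + 1) ∈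
      evenStage n q ω (k + 1) :=
  ⟨(t, (fun x => (ω ^ 2) • x)^[j] x),
    ⟨ht, Set.mem_biUnion (Finset.mem_range.2 hj) ⟨x, hx, rfl⟩⟩, rfl⟩

lemma basisVector_mem_evenStage {q : ℕ} (hq : 0 < q) (ω : ℂ) (k : ℕ) :
    basisVector n k ∈ evenStage n q ω k := by
  induction k with
  | zero => rfl
  | succ k ih =>
    simpa using mem_evenStage_succ hq (mem_oddStage ih (t := 0) (by simp)).1 (t := 1) (by simp)

lemma smul_basisVector_mem_oddStage {q : ℕ} (hq : 0 < q) (ω : ℂ) (k : ℕ) :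
    ω • basisVector n k ∈ oddStage n q ω k := by
  simpa using (mem_oddStage (basisVector_mem_evenStage (n := n) hq ω k) (t := 1) (by simp)).1

lemma oddStage_of_evenStage {q : ℕ} {ω : ℂ} (hω : 0 < ω.im) {k : ℕ} (hk : k < n)
    (h : ∀ x ∈ evenStage n q ω k, x ≠ 0 ∧ (∀ i : Fin n, k < i → x i = 0) ∧
      ∃ s : ℝ, 0 ≤ s ∧ x ⟨k, hk⟩ = s) :
    ∀ x ∈ oddStage n q ω k, x ≠ 0 ∧ ∀ i : Fin n, k < i → x i = 0 := by
  have hω0 : ω ≠ 0 := by rintro rfl; simp at hω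
  rintro _ ⟨⟨t, x⟩, ⟨ht, hx⟩, rfl⟩
  rcases hx with hx | ⟨x, hx, rfl⟩ <;> obtain ⟨hx0, hxi, s, hs, hxs⟩ := h x hx <;>
    refine ⟨fun h0 => ?_, fun i hi => by simp [hxi i hi, basisVector, hi.ne']⟩
  · have h1 := congrArg (fun y : EuclideanSpace ℂ (Fin n) => (y ⟨k, hk⟩).im) h0
    simp [hxs, basisVector] at h1
    rcases h1 with rfl | h1
    · simp at h0
      exact hx0 h0
    · exact hω.ne' h1
  · have h1 := congrArg (fun y : EuclideanSpace ℂ (Fin n) => y ⟨k, hk⟩) h0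
    simp [hxs, basisVector] at h1
    have h2 : ω * (((1 - t) * s : ℝ) * ω + (t : ℝ)) = 0 := by
      push_cast
      linear_combination h1
    have h3 := (mul_eq_zero.1 h2).resolve_left hω0
    have h4 : (1 - t) * s = 0 := by
      have := congrArg Complex.im h3
      simp at this
      rcases this with (h | h) | h
      · simp [h]
      · simp [h]
      · exact absurd h hω.ne'
    have h5 : t = 0 := by
      rw [h4] at h3
      simpa using h3
    subst h5
    simp [hω0] at h0
    exact hx0 h0

lemma evenStage_spec {q : ℕ} {ω : ℂ} (hω : 0 < ω.im) {k : ℕ} (hk : k < n) :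
    ∀ x ∈ evenStage n q ω k, x ≠ 0 ∧ (∀ i : Fin n, k < i → x i = 0) ∧
      ∃ s : ℝ, 0 ≤ s ∧ x ⟨k, hk⟩ = s := by
  have hω0 : ω ≠ 0 := by rintro rfl; simp at hω
  induction k with
  | zero =>
    rintro _ rfl
    refine ⟨fun h => ?_, fun i hi => by simp [basisVector, hi.ne'], 1, zero_le_one, ?_⟩
    · simpa [basisVector] using congrArg (fun y : EuclideanSpace ℂ (Fin n) => y ⟨0, hk⟩) h
    · simp [basisVector]
  | succ k ih =>
    rintro _ ⟨⟨t, y⟩, ⟨ht, hy⟩, rfl⟩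
    simp only [Set.mem_iUnion] at hy
    obtain ⟨j, -, x, hx, rfl⟩ := hy
    obtain ⟨hx0, hxi⟩ := oddStage_of_evenStage hω (by omega) (ih (by omega)) x hx
    have hxk : x ⟨k + 1, hk⟩ = 0 := hxi _ (Nat.lt_succ_self k)
    refine ⟨fun h0 => ?_, fun i hi => ?_, t, ht.1, ?_⟩
    · have h1 := congrArg (fun y : EuclideanSpace ℂ (Fin n) => y ⟨k + 1, hk⟩) h0
      simp [basisVector, smul_iterate, hxk] at h1
      subst h1
      simp [smul_iterate, hω0] at h0
      exact hx0 h0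
    · simp [basisVector, smul_iterate, hi.ne', hxi i (by omega)]
    · simp [basisVector, smul_iterate, hxk]

lemma oddStage_ne_zero {q : ℕ} {ω : ℂ} (hω : 0 < ω.im) {k : ℕ} (hk : k < n)
    {x : EuclideanSpace ℂ (Fin n)} (hx : x ∈ oddStage n q ω k) : x ≠ 0 :=
  (oddStage_of_evenStage hω hk (evenStage_spec hω hk) x hx).1

/-- The odd stages below the top stay away from the origin. -/
lemma exists_le_norm_oddStage (n q : ℕ) {ω : ℂ} (hω : 0 < ω.im) :
    ∃ r > 0, ∀ k < n, ∀ x ∈ oddStage n q ω k, r ≤ ‖x‖ := by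
  have hK : IsClosed (⋃ k ∈ Finset.range n, oddStage n q ω k) :=
    (Finset.isCompact_biUnion _ fun k _ => isCompact_oddStage q ω k).isClosed
  have h0 : (0 : EuclideanSpace ℂ (Fin n)) ∈ (⋃ k ∈ Finset.range n, oddStage n q ω k)ᶜ := by
    simp only [Set.mem_compl_iff, Set.mem_iUnion, not_exists]
    intro k hk hx
    exact oddStage_ne_zero hω (Finset.mem_range.1 hk) hx rfl
  obtain ⟨r, hr, h⟩ := Metric.isOpen_iff.1 hK.isOpen_compl 0 h0
  refine ⟨r, hr, fun k hk x hx => ?_⟩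
  by_contra! hlt
  exact h (by simpa using hlt) (Set.mem_biUnion (Finset.mem_range.2 hk) hx)

end JoinFiltration

/-- A nullhomotopic self-map of the unit sphere extends to a continuous map into the sphere, of
the whole space, which is given by the radial extension outside a ball. -/
lemma exists_extension_of_nullhomotopic {E : Type*} [NormedAddCommGroup E] [NormedSpace ℝ E]
    {f : C(Metric.sphere (0 : E) 1, Metric.sphere (0 : E) 1)} (hf : f.Nullhomotopic)
    {r : ℝ} (hr : 0 < r) :
    ∃ F : E → E, Continuous F ∧ (∀ x, ‖F x‖ = 1) ∧
      ∀ x, r ≤ ‖x‖ → ∀ y : Metric.sphere (0 : E) 1, (y : E) = ‖x‖⁻¹ • x → F x = f y := by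
  obtain ⟨p, ⟨H⟩⟩ := hf
  have hmem : ∀ x : E, x ≠ 0 → ‖x‖⁻¹ • x ∈ Metric.sphere (0 : E) 1 := fun x hx => by
    simp [norm_smul, hx]
  classical
  set F : E → E := fun x => if hx : x = 0 then p else
    H (Set.projIcc 0 1 zero_le_one (2 - 2 * ‖x‖ / r), ⟨‖x‖⁻¹ • x, hmem x hx⟩) with hF
  have hF0 : ∀ x, x ≠ 0 → ∀ y : Metric.sphere (0 : E) 1, (y : E) = ‖x‖⁻¹ • x →
      F x = H (Set.projIcc 0 1 zero_le_one (2 - 2 * ‖x‖ / r), y) := by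
    intro x hx y hy
    simp only [hF, dif_neg hx]
    congr 3
    exact Subtype.ext hy.symm
  have hcenter : ∀ x, ‖x‖ ≤ r / 2 → F x = p := by
    intro x hx
    by_cases h : x = 0
    · simp [hF, h]
    · rw [hF0 x h ⟨_, hmem x h⟩ rfl, Set.projIcc_of_right_le]
      · exact congrArg Subtype.val (H.apply_one _)
      · have : 2 * ‖x‖ / r ≤ 1 := by rw [div_le_one hr]; linarith
        linarith
  refine ⟨F, ?_, fun x => ?_, fun x hx y hy => ?_⟩
  · rw [continuous_iff_continuousAt]
    intro x
    by_cases h : x = 0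
    · subst h
      refine (continuousAt_const (y := (p : E))).congr ?_
      filter_upwards [Metric.closedBall_mem_nhds (0 : E) (half_pos hr)] with x hx
      exact (hcenter x (by simpa using hx)).symm
    · have hopen : IsOpen {x : E | x ≠ 0} := isOpen_ne
      refine ContinuousOn.continuousAt (s := {x | x ≠ 0}) ?_ (hopen.mem_nhds h)
      rw [continuousOn_iff_continuous_domRestrict]
      have : Set.domRestrict {x : E | x ≠ 0} F = fun x : {x : E | x ≠ 0} =>
          (H (Set.projIcc 0 1 zero_le_one (2 - 2 * ‖(x : E)‖ / r),
            ⟨‖(x : E)‖⁻¹ • (x : E), hmem x x.2⟩) : E) := by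
        ext x
        exact hF0 x x.2 _ rfl
      rw [this]
      have hinv : Continuous fun x : {x : E | x ≠ 0} => ‖(x : E)‖⁻¹ :=
        (continuous_norm.comp continuous_subtype_val).inv₀ fun x => norm_ne_zero_iff.2 x.2
      refine continuous_subtype_val.comp (H.continuous.comp (Continuous.prodMk ?_ ?_))
      · exact continuous_projIcc.comp (by fun_prop)
      · exact (hinv.smul continuous_subtype_val).subtype_mk _
  · by_cases h : x = 0
    · simp [hF, h]
    · rw [hF0 x h ⟨_, hmem x h⟩ rfl]
      simp
  · have h : x ≠ 0 := by
      rintro rfl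
      simp at hx
      linarith
    rw [hF0 x h y hy, Set.projIcc_of_le_left]
    · exact congrArg Subtype.val (H.apply_zero _)
    · have : 2 ≤ 2 * ‖x‖ / r := by rw [le_div_iff₀ hr]; linarith
      linarith

namespace OrderedChain

lemma div_two_pi_mem_integers {θ : ℝ} (h : (θ : Real.Angle) = 0) :
    θ / (2 * Real.pi) ∈ integers := by
  obtain ⟨k, hk⟩ := Real.Angle.coe_eq_zero_iff.1 h
  refine ⟨k, ?_⟩
  have := Real.pi_ne_zero
  simp only [Int.coe_castAddHom, ← hk, zsmul_eq_mul]
  field_simp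

/-- The principal angle from `a` to `b`, as a fraction of a full turn. -/
noncomputable def turn (a b : ℂ) : ℝ := (b / a).arg / (2 * Real.pi)

lemma turn_sub_mem_integers {a b : ℂ} (ha : a ≠ 0) (hb : b ≠ 0) :
    turn a b - (b.arg / (2 * Real.pi) - a.arg / (2 * Real.pi)) ∈ integers := by
  have h : (((b / a).arg - (b.arg - a.arg) : ℝ) : Real.Angle) = 0 := by
    rw [Real.Angle.coe_sub, Complex.arg_div_coe_angle hb ha, Real.Angle.coe_sub, sub_self]
  convert div_two_pi_mem_integers h using 1
  rw [turn]
  ring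

lemma turn_coboundary_mem_integers {a b d : ℂ} (ha : a ≠ 0) (hb : b ≠ 0) (hd : d ≠ 0) :
    turn a b + turn b d - turn a d ∈ integers := by
  convert sub_mem (add_mem (turn_sub_mem_integers ha hb) (turn_sub_mem_integers hb hd))
    (turn_sub_mem_integers ha hd) using 1
  ring

lemma arg_mul_sub_mem_integers {a : ℂ} (ha : a ≠ 0) (q : ℕ) :
    (Complex.exp (2 * Real.pi * Complex.I / q) * a).arg / (2 * Real.pi) -
      a.arg / (2 * Real.pi) - 1 / q ∈ integers := by
  have he : Complex.exp (2 * Real.pi * Complex.I / q) =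
      Complex.cos (2 * Real.pi / q : ℝ) + Complex.sin (2 * Real.pi / q : ℝ) * Complex.I := by
    rw [← Complex.exp_mul_I]
    congr 1
    push_cast
    ring
  have harg : ((Complex.exp (2 * Real.pi * Complex.I / q)).arg : Real.Angle) =
      (2 * Real.pi / q : ℝ) := by
    rw [he, ← Complex.arg_cos_add_sin_mul_I_coe_angle (2 * Real.pi / q : ℝ),
      Real.Angle.cos_coe, Real.Angle.sin_coe, Complex.ofReal_cos, Complex.ofReal_sin]
  have h : (((Complex.exp (2 * Real.pi * Complex.I / q) * a).arg - a.arg -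
      2 * Real.pi / q : ℝ) : Real.Angle) = 0 := by
    rw [Real.Angle.coe_sub, Real.Angle.coe_sub,
      Complex.arg_mul_coe_angle (Complex.exp_ne_zero _) ha, harg]
    abel
  convert div_two_pi_mem_integers h using 1
  have := Real.pi_ne_zero
  field_simp

lemma abs_turn_lt {a b : ℂ} (h : ‖b - a‖ < ‖a‖) : |turn a b| < 1 / 4 := by
  have ha : a ≠ 0 := norm_pos_iff.1 ((norm_nonneg _).trans_lt h)
  have h1 : ‖1 - b / a‖ < 1 := by
    rw [show 1 - b / a = -((b - a) / a) by field_simp; ring, norm_neg, norm_div,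
      div_lt_one (norm_pos_iff.2 ha)]
    exact h
  have h2 : 0 < (b / a).re := by
    have := (Complex.re_le_norm (1 - b / a)).trans_lt h1
    simp only [Complex.sub_re, Complex.one_re] at this
    linarith
  have h3 := Complex.abs_arg_lt_pi_div_two_iff.2 (Or.inl h2)
  rw [turn, abs_div, abs_of_pos Real.two_pi_pos, div_lt_iff₀ Real.two_pi_pos]
  linarith

lemma turn_coboundary_eq_zero {a b d : ℂ} (hab : ‖b - a‖ < ‖a‖) (hbd : ‖d - b‖ < ‖b‖)
    (had : ‖d - a‖ < ‖a‖) (hd : d ≠ 0) : turn a b + turn b d - turn a d = 0 := by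
  have ha : a ≠ 0 := norm_pos_iff.1 ((norm_nonneg _).trans_lt hab)
  have hb : b ≠ 0 := norm_pos_iff.1 ((norm_nonneg _).trans_lt hbd)
  obtain ⟨k, hk⟩ := turn_coboundary_mem_integers ha hb hd
  have h1 := abs_lt.1 (abs_turn_lt hab)
  have h2 := abs_lt.1 (abs_turn_lt hbd)
  have h3 := abs_lt.1 (abs_turn_lt had)
  simp only [Int.coe_castAddHom] at hk
  have hlt : (k : ℝ) < 1 := by linarith
  have hgt : (-1 : ℝ) < k := by linarith
  have : k = 0 := by
    have h4 : k < 1 := by exact_mod_cast hlt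
    have h5 : -1 < k := by exact_mod_cast hgt
    omega
  rw [← hk, this, Int.cast_zero]

end OrderedChain

/-- A homogeneous choice of a nonzero coordinate of a nonzero vector, preferring the `i`-th. -/
lemma exists_homogeneous_coordinate {n : ℕ} (hn : 1 ≤ n) (i : ℕ) :
    ∃ s : EuclideanSpace ℂ (Fin n) → ℂ, (∀ w, w ≠ 0 → s w ≠ 0) ∧
      (∀ a : ℂ, a ≠ 0 → ∀ w, s (a • w) = a * s w) ∧
      ∀ (hi : i < n) w, w ⟨i, hi⟩ ≠ 0 → s w = w ⟨i, hi⟩ := by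
  have : Nonempty (Fin n) := ⟨⟨0, hn⟩⟩
  set P : EuclideanSpace ℂ (Fin n) → Fin n → Prop := fun w j =>
    w j ≠ 0 ∧ ((∃ l : Fin n, (l : ℕ) = i ∧ w l ≠ 0) → (j : ℕ) = i) with hP
  have hex : ∀ w, w ≠ 0 → P w (Classical.epsilon (P w)) := by
    intro w hw
    apply Classical.epsilon_spec
    by_cases h : ∃ l : Fin n, (l : ℕ) = i ∧ w l ≠ 0
    · obtain ⟨l, hl, hwl⟩ := h
      exact ⟨l, hwl, fun _ => hl⟩
    · obtain ⟨j, hj⟩ : ∃ j, w j ≠ 0 := by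
        by_contra! h0
        exact hw (by ext j; simpa using h0 j)
      exact ⟨j, hj, fun h' => absurd h' h⟩
  refine ⟨fun w => w (Classical.epsilon (P w)), fun w hw => (hex w hw).1, fun a ha w => ?_,
    fun hi w hw => ?_⟩
  · have : P (a • w) = P w := by
      ext j
      simp [hP, ha]
    simp [this]
  · have h0 : w ≠ 0 := by
      rintro rfl
      simp at hw
    have h := (hex w h0).2 ⟨⟨i, hi⟩, rfl, hw⟩
    exact congrArg (fun j => w j) (Fin.ext h)

lemma exists_inv_le_norm_apply {n : ℕ} (w : EuclideanSpace ℂ (Fin n)) (hw : ‖w‖ = 1) :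
    ∃ i, 1 / (n : ℝ) ≤ ‖w i‖ := by
  by_contra! h
  have hsq := EuclideanSpace.norm_sq_eq w
  rw [hw] at hsq
  rcases Nat.eq_zero_or_pos n with rfl | hn
  · simp at hsq
  have hn1 : (1 : ℝ) ≤ n := by exact_mod_cast hn
  have : Nonempty (Fin n) := ⟨⟨0, hn⟩⟩
  have hlt : ∑ i, ‖w i‖ ^ 2 < ∑ _i : Fin n, 1 / (n : ℝ) := by
    refine Finset.sum_lt_sum_of_nonempty Finset.univ_nonempty fun i _ => ?_
    have h1 : ‖w i‖ < 1 := (h i).trans_le ((div_le_one (by linarith)).2 hn1)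
    nlinarith [h i, norm_nonneg (w i)]
  rw [← hsq] at hlt
  simp at hlt
  rw [mul_inv_cancel₀ (by linarith)] at hlt
  linarith

open Complex

/-- No continuous selfmap of the unit sphere of `ℂ^n` (`n ≥ 1`) that is equivariant with
respect to multiplication by the primitive `q`-th root of unity `ζ = exp (2πi/q)` (`q ≥ 2`)
is nullhomotopic.  Since `‖ζ‖ = 1`, for a point `x` of the unit sphere the point with
underlying vector `ζ • ↑x` again lies on the unit sphere; equivariance is expressed via
underlying vectors. -/
theorem zeta_equivariant_selfmap_not_nullhomotopic (n q : ℕ) (hn : 1 ≤ n) (hq : 2 ≤ q)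
    (f : C((Metric.sphere (0 : EuclideanSpace ℂ (Fin n)) 1),
      (Metric.sphere (0 : EuclideanSpace ℂ (Fin n)) 1)))
    (hequiv : ∀ x y : (Metric.sphere (0 : EuclideanSpace ℂ (Fin n)) 1),
      (y : EuclideanSpace ℂ (Fin n)) = Complex.exp (2 * Real.pi * Complex.I / q) • ↑x →
        (f y : EuclideanSpace ℂ (Fin n)) =
          Complex.exp (2 * Real.pi * Complex.I / q) • ↑(f x)) :
    ¬ f.Nullhomotopic := by
  intro hf
  have hq0 : q ≠ 0 := by omega
  have hqR : (2 : ℝ) ≤ q := by exact_mod_cast hq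
  set ζ : ℂ := Complex.exp (2 * Real.pi * Complex.I / q) with hζ
  set ω : ℂ := Complex.exp (Real.pi * Complex.I / q) with hω
  have hωζ : ω ^ 2 = ζ := by
    rw [hω, hζ, ← Complex.exp_nat_mul]
    congr 1
    push_cast
    ring
  have hωim : 0 < ω.im := by
    have : (Real.pi * Complex.I / q : ℂ) = (Real.pi / q : ℝ) * Complex.I := by
      push_cast
      ring
    rw [hω, this, Complex.exp_ofReal_mul_I_im]
    refine Real.sin_pos_of_pos_of_lt_pi (by positivity) ?_
    rw [div_lt_iff₀ (by linarith)]
    nlinarith [Real.pi_pos]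
  have hζ0 : ζ ≠ 0 := Complex.exp_ne_zero _
  have hζq : ζ ^ q = 1 := (Complex.isPrimitiveRoot_exp q hq0).pow_eq_one
  have hζ1 : ‖ζ‖ = 1 := Complex.norm_eq_one_of_pow_eq_one hζq hq0
  obtain ⟨r, hr, hrZ⟩ := JoinFiltration.exists_le_norm_oddStage n q hωim
  obtain ⟨F, hFc, hF1, hFf⟩ := exists_extension_of_nullhomotopic hf hr
  have hF0 : ∀ x, F x ≠ 0 := fun x => norm_ne_zero_iff.1 (by simp [hF1])
  have hFζ : ∀ x, r ≤ ‖x‖ → F (ζ • x) = ζ • F x := by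
    intro x hx
    have hx0 : x ≠ 0 := norm_pos_iff.1 (hr.trans_le hx)
    have hn1 : ‖ζ • x‖ = ‖x‖ := by rw [norm_smul, hζ1, one_mul]
    have hmem : ‖x‖⁻¹ • x ∈ Metric.sphere (0 : EuclideanSpace ℂ (Fin n)) 1 := by
      simp [norm_smul, hx0]
    have hmem' : ‖x‖⁻¹ • ζ • x ∈ Metric.sphere (0 : EuclideanSpace ℂ (Fin n)) 1 := by
      simp [norm_smul, hx0, hζ1]
    rw [hFf x hx ⟨_, hmem⟩ rfl, hFf (ζ • x) (hn1.symm ▸ hx) ⟨_, hmem'⟩ (by rw [hn1])]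
    exact hequiv _ _ (smul_comm _ _ _)
  choose s hs0 hsζ hsi using exists_homogeneous_coordinate hn
  obtain ⟨ε, hε, hεF⟩ := Metric.uniformContinuousOn_iff.1
    ((JoinFiltration.isCompact_evenStage q ω n).uniformContinuousOn_of_continuous
      hFc.continuousOn) (1 / (4 * n : ℝ)) (by positivity)
  have hT : Isometry fun x : EuclideanSpace ℂ (Fin n) => (ω ^ 2) • x :=
    Isometry.of_dist_eq fun x y => by rw [dist_smul₀, hωζ, hζ1, one_mul]
  obtain ⟨α, hα, k, hk⟩ := OrderedChain.exists_small_chain (n := n) hT hq0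
    (by
      rw [smul_iterate, hωζ, hζq]
      ext x
      simp)
    (Z := {x | r ≤ ‖x‖})
    (fun x hx => by
      change r ≤ ‖(ω ^ 2) • x‖
      rw [norm_smul, hωζ, hζ1, one_mul]
      exact hx)
    (fun k => (JoinFiltration.isCompact_evenStage q ω k).isBounded)
    (fun k => (JoinFiltration.isCompact_oddStage q ω k).isBounded)
    (JoinFiltration.basisVector_mem_evenStage (by omega) ω)
    (JoinFiltration.smul_basisVector_mem_oddStage (by omega) ω)
    (fun _ _ hx _ ht => JoinFiltration.mem_oddStage hx ht)
    (fun _ _ hx _ hj _ ht => JoinFiltration.mem_evenStage_succ hj hx ht)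
    (fun k hk x hx => hrZ k hk x hx)
    (c := fun i x y => OrderedChain.turn (s i (F x)) (s i (F y)))
    (g := fun i x => (s i (F x)).arg / (2 * Real.pi))
    (fun i x y z => OrderedChain.turn_coboundary_mem_integers (hs0 i _ (hF0 x))
      (hs0 i _ (hF0 y)) (hs0 i _ (hF0 z)))
    (fun i x hx y hy => by
      simp only [hωζ, hFζ x hx, hFζ y hy, hsζ i ζ hζ0, OrderedChain.turn,
        mul_div_mul_left _ _ hζ0])
    (fun i x y => OrderedChain.turn_sub_mem_integers (hs0 i _ (hF0 x)) (hs0 i _ (hF0 y)))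
    (fun i x hx => by
      simp only [hωζ, hFζ x hx, hsζ i ζ hζ0]
      exact OrderedChain.arg_mul_sub_mem_integers (hs0 i _ (hF0 x)) q)
    (ε := ε) hε
  have hzero : OrderedChain.eval (OrderedChain.cupPower
      (fun i x y => OrderedChain.turn (s i (F x)) (s i (F y))) n) α = 0 := by
    refine OrderedChain.hom_eq_of_span _ 0 (fun l hl => ?_) hα
    obtain ⟨x₀, hx₀⟩ : ∃ x, x ∈ l :=
      List.exists_mem_of_length_pos (by rw [hl.length_eq]; omega)
    obtain ⟨i, hi⟩ := exists_inv_le_norm_apply (F x₀) (hF1 x₀)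
    have hclose : ∀ x ∈ l, ∀ y ∈ l, ‖F y i - F x i‖ < 1 / (4 * n : ℝ) := by
      intro x hx y hy
      refine (PiLp.norm_apply_le (F y - F x) i).trans_lt ?_
      rw [← dist_eq_norm]
      exact hεF y (hl.mem y hy) x (hl.mem x hx) (hl.dist_lt y hy x hx)
    have hlarge : ∀ x ∈ l, 1 / (4 * n : ℝ) < ‖F x i‖ := by
      intro x hx
      have h₁ := hclose x hx x₀ hx₀
      have h₂ := norm_sub_norm_le (F x₀ i) (F x i)
      have h₃ : 1 / (n : ℝ) = 4 * (1 / (4 * n : ℝ)) := by field_simp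
      have h₄ : 0 < 1 / (4 * n : ℝ) := by positivity
      linarith
    have hne : ∀ x ∈ l, F x i ≠ 0 := fun x hx =>
      norm_pos_iff.1 (lt_trans (by positivity) (hlarge x hx))
    rw [OrderedChain.eval_of, AddMonoidHom.zero_apply]
    refine OrderedChain.cupPower_eq_zero i.2 l fun x hx y hy z hz => ?_
    rw [hsi i i.2 _ (hne x hx), hsi i i.2 _ (hne y hy), hsi i i.2 _ (hne z hz)]
    exact OrderedChain.turn_coboundary_eq_zero ((hclose x hx y hy).trans (hlarge x hx))
      ((hclose y hy z hz).trans (hlarge y hy)) ((hclose x hx z hz).trans (hlarge x hx))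
      (hne z hz)
  rw [hzero] at hk
  have hk' : (q : ℤ) * k = -1 := by
    have : ((q * k : ℤ) : ℝ) = ((-1 : ℤ) : ℝ) := by
      push_cast
      linarith
    exact_mod_cast this
  have hdvd : (q : ℤ) ∣ 1 := ⟨-k, by linarith⟩
  have := Int.le_of_dvd one_pos hdvd
  omega
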